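/- arXiv:1501.06388 — 4 statements merged into one kernel-verified Lean document; each statement's English description precedes it below -/
import Mathlib

section
/- Let (X, μ) and (Y, ν) be strong GT-spaces and f : X → Y a surjective g-pseudo-open mapping. Then f is hereditarily g-pseudo-open: for each Y′ ⊆ Y, the restriction f|_{f⁻¹(Y′)} : (f⁻¹(Y′), μ′) → (Y′, ν′) is g-pseudo-open, where μ′ = {U ∩ f⁻¹(Y′) : U ∈ μ} and ν′ = {V ∩ Y′ : V ∈ ν}. -/
open Set

/-- A strong generalized topology on `X`: contains `∅` and `univ`,
and is closed under arbitrary unions. -/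
def IsStrongGT {X : Type*} (μ : Set (Set X)) : Prop :=
  ∅ ∈ μ ∧ univ ∈ μ ∧ ∀ S ⊆ μ, ⋃₀ S ∈ μ

/-- The interior of `B`: the union of all `μ`-open subsets of `B`. -/
def gInt {X : Type*} (μ : Set (Set X)) (B : Set X) : Set X :=
  ⋃₀ {U | U ∈ μ ∧ U ⊆ B}

/-- The closure of `B`: the intersection of all `μ`-closed sets containing `B`. -/
def gCl {X : Type*} (μ : Set (Set X)) (B : Set X) : Set X :=
  ⋂₀ {F | Fᶜ ∈ μ ∧ B ⊆ F}

/-- The closure of `A` in the subspace of `X` with carrier `X'` and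
generalized topology `μ'` (a family of subsets of `X'`): the intersection of
all `μ'`-closed subsets of `X'` containing `A`. -/
def gClIn {X : Type*} (X' : Set X) (μ' : Set (Set X)) (A : Set X) : Set X :=
  ⋂₀ {F | F ⊆ X' ∧ X' \ F ∈ μ' ∧ A ⊆ F}

/-- The subspace generalized topology on `X' ⊆ X` induced by `μ`. -/
def gSub {X : Type*} (μ : Set (Set X)) (X' : Set X) : Set (Set X) :=
  {W | ∃ U ∈ μ, W = U ∩ X'}

theorem hereditarily_gPseudoOpen {X Y : Type*} (μ : Set (Set X)) (ν : Set (Set Y))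
    (hμ : IsStrongGT μ) (hν : IsStrongGT ν) (f : X → Y)
    (hsurj : Function.Surjective f)
    (hf : ∀ y : Y, ∀ U ∈ μ, f ⁻¹' {y} ⊆ U → y ∈ gInt ν (f '' U)) (Y' : Set Y) :
    ∀ y ∈ Y', ∀ W ∈ gSub μ (f ⁻¹' Y'),
      f ⁻¹' {y} ∩ f ⁻¹' Y' ⊆ W → y ∈ gInt (gSub ν Y') (f '' W) := by
  rintro y hy W ⟨U, hU, rfl⟩ hW
  obtain ⟨V, ⟨hV, hVU⟩, hyV⟩ := hf y U hU (by
    intro x hx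
    have hxy : f x = y := hx
    exact (hW ⟨hx, show f x ∈ Y' from hxy ▸ hy⟩).1)
  refine ⟨V ∩ Y', ⟨⟨V, hV, rfl⟩, ?_⟩, hyV, hy⟩
  rintro z ⟨hz, hz'⟩
  obtain ⟨x, hx, rfl⟩ := hVU hz
  exact ⟨x, ⟨hx, hz'⟩, rfl⟩
end

section
/- Let (X, μ) and (Y, ν) be strong GT-spaces and f : X → Y a surjective g-continuous mapping. Then f is a g-open mapping if and only if f⁻¹(C(B)) = C(f⁻¹(B)) for each B ⊆ Y. -/
open Set

theorem gOpen_iff_of_gContinuous {X Y : Type*} (μ : Set (Set X)) (ν : Set (Set Y))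
    (hμ : IsStrongGT μ) (hν : IsStrongGT ν) (f : X → Y)
    (hsurj : Function.Surjective f) (hcont : ∀ V ∈ ν, f ⁻¹' V ∈ μ) :
    (∀ U ∈ μ, f '' U ∈ ν) ↔ (∀ B : Set Y, f ⁻¹' gCl ν B = gCl μ (f ⁻¹' B)) := by
  constructor
  · intro hopen B
    ext x
    constructor
    · rintro hx F ⟨hF, hBF⟩
      by_contra hxF
      have h := hx (f '' Fᶜ)ᶜ ⟨by rw [compl_compl]; exact hopen _ hF, by
        rintro b hb ⟨z, hz, rfl⟩
        exact hz (hBF hb)⟩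
      exact h ⟨x, hxF, rfl⟩
    · rintro hx F ⟨hF, hBF⟩
      exact hx (f ⁻¹' F) ⟨hcont _ hF, fun z hz => hBF hz⟩
  · intro h U hU
    have key : f '' U = ⋃₀ {V | V ∈ ν ∧ V ⊆ f '' U} := by
      apply Subset.antisymm
      · rintro _ ⟨x, hx, rfl⟩
        by_contra hn
        have h1 : x ∈ f ⁻¹' gCl ν (f '' U)ᶜ := by
          rintro F ⟨hF, hBF⟩
          by_contra hxF
          refine hn ⟨Fᶜ, ⟨hF, ?_⟩, hxF⟩
          exact compl_subset_comm.mp hBF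
        rw [h] at h1
        exact h1 Uᶜ ⟨by rw [compl_compl]; exact hU, fun z hz hzU => hz ⟨z, hzU, rfl⟩⟩ hx
      · exact sUnion_subset fun V hV => hV.2
    rw [key]
    exact hν.2.2 _ fun V hV => hV.1
end

section
/- Let (X, μ) and (Y, ν) be strong GT-spaces and f : X → Y a surjective mapping. Then the following are equivalent: (1) f is a g-pseudo-open mapping; (2) f is a hereditarily g-quotient mapping, i.e., for each Y′ ⊆ Y the restriction f|_{f⁻¹(Y′)} : (f⁻¹(Y′), μ′) → (Y′, ν′) is g-quotient, where μ′ = {U ∩ f⁻¹(Y′) : U ∈ μ} and ν′ = {V ∩ Y′ : V ∈ ν}; (3) C(B) ⊆ f(C(f⁻¹(B))) for each B ⊆ Y. -/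
open Set

theorem gPseudoOpen_tfae {X Y : Type*} (μ : Set (Set X)) (ν : Set (Set Y))
    (hμ : IsStrongGT μ) (hν : IsStrongGT ν) (f : X → Y)
    (hsurj : Function.Surjective f) :
    [ (∀ y : Y, ∀ U ∈ μ, f ⁻¹' {y} ⊆ U → y ∈ gInt ν (f '' U)),
      (∀ Y' : Set Y, ∀ V ⊆ Y',
        f ⁻¹' V ∩ f ⁻¹' Y' ∈ gSub μ (f ⁻¹' Y') → V ∈ gSub ν Y'),
      (∀ B : Set Y, gCl ν B ⊆ f '' gCl μ (f ⁻¹' B)) ].TFAE := by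
  tfae_have 1 → 2 := by
    rintro h Y' V hV ⟨U, hU, hUe⟩
    refine ⟨gInt ν (f '' U), hν.2.2 _ (fun W hW => hW.1), ?_⟩
    have key : ∀ x, f x ∈ Y' → (f x ∈ V ↔ x ∈ U) := by
      intro x hx
      have := Set.ext_iff.1 hUe x
      simp only [mem_inter_iff, mem_preimage, hx, and_true] at this
      exact this
    ext y
    constructor
    · intro hy
      refine ⟨h y U hU ?_, hV hy⟩
      intro x hx
      have hx' : f x = y := hx
      subst hx'
      exact (key x (hV hy)).1 hy
    · rintro ⟨⟨W, ⟨_, hWU⟩, hyW⟩, hy⟩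
      obtain ⟨x, hx, rfl⟩ := hWU hyW
      exact (key x hy).2 hx
  tfae_have 2 → 3 := by
    intro h B y hy
    by_contra hn
    have hcl : ∀ x, f x = y → x ∉ gCl μ (f ⁻¹' B) := fun x hx hc => hn ⟨x, hc, hx⟩
    have hsub : f ⁻¹' B ⊆ gCl μ (f ⁻¹' B) := fun x hx F hF => hF.2 hx
    have hopen : (gCl μ (f ⁻¹' B))ᶜ ∈ μ := by
      have : (gCl μ (f ⁻¹' B))ᶜ = ⋃₀ {U | U ∈ μ ∧ f ⁻¹' B ⊆ Uᶜ} := by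
        ext x
        simp only [gCl, mem_compl_iff, mem_sInter, mem_sUnion, mem_setOf_eq, not_forall]
        constructor
        · rintro ⟨F, hF, hx⟩
          exact ⟨Fᶜ, ⟨hF.1, by simpa using hF.2⟩, hx⟩
        · rintro ⟨U, hU, hx⟩
          exact ⟨Uᶜ, ⟨by simpa using hU.1, hU.2⟩, by simpa using hx⟩
      rw [this]
      exact hμ.2.2 _ (fun W hW => hW.1)
    obtain ⟨W, hW, hWe⟩ := h (insert y B) {y} (by simp) ⟨_, hopen, by
      ext x
      constructor
      · rintro ⟨hx, hx2⟩
        exact ⟨hcl x hx, hx2⟩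
      · rintro ⟨hx, hx2⟩
        refine ⟨?_, hx2⟩
        rcases hx2 with hx2 | hx2
        · exact hx2
        · exact absurd (hsub hx2) hx⟩
    have hyW : y ∈ W ∩ insert y B := hWe ▸ mem_singleton y
    refine hy Wᶜ ⟨by simpa using hW, ?_⟩ hyW.1
    intro b hb hbW
    have hby : b ∈ ({y} : Set Y) := hWe ▸ ⟨hbW, Or.inr hb⟩
    have hby' : b = y := hby
    subst hby'
    obtain ⟨x, rfl⟩ := hsurj b
    exact hcl x rfl (hsub hb)
  tfae_have 3 → 1 := by
    intro h y U hU hyU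
    by_contra hn
    have hc : y ∈ gCl ν (f '' U)ᶜ := by
      rintro F ⟨hF, hBF⟩
      by_contra hyF
      exact hn ⟨Fᶜ, ⟨hF, compl_subset_comm.1 hBF⟩, hyF⟩
    obtain ⟨x, hx, hxy⟩ := h _ hc
    refine hx Uᶜ ⟨by simpa using hU, ?_⟩ (hyU hxy)
    intro z hz hzU
    exact hz ⟨z, hzU, rfl⟩
  tfae_finish
end

section
/- Let (X, μ) and (Y, ν) be strong GT-spaces and f : X → Y a surjective g-continuous mapping. Then f is a g-pseudo-open mapping if and only if C(B) = f(C(f⁻¹(B))) for each B ⊆ Y. -/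
open Set

theorem gPseudoOpen_iff_of_gContinuous {X Y : Type*} (μ : Set (Set X)) (ν : Set (Set Y))
    (hμ : IsStrongGT μ) (hν : IsStrongGT ν) (f : X → Y)
    (hsurj : Function.Surjective f) (hcont : ∀ V ∈ ν, f ⁻¹' V ∈ μ) :
    (∀ y : Y, ∀ U ∈ μ, f ⁻¹' {y} ⊆ U → y ∈ gInt ν (f '' U)) ↔
      (∀ B : Set Y, gCl ν B = f '' gCl μ (f ⁻¹' B)) := by
  have hmem : ∀ (B : Set Y) (y : Y), y ∈ gCl ν B ↔ ∀ F : Set Y, Fᶜ ∈ ν → B ⊆ F → y ∈ F := by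
    intro B y
    simp only [gCl, mem_sInter, mem_setOf_eq, and_imp]
  constructor
  · intro h B
    apply Subset.antisymm
    · intro y hy
      by_contra hn
      have hU : (gCl μ (f ⁻¹' B))ᶜ ∈ μ := by
        rw [gCl, compl_sInter]
        apply hμ.2.2
        rintro _ ⟨F, hF, rfl⟩
        exact hF.1
      obtain ⟨V, ⟨hV, hVU⟩, hyV⟩ := h y _ hU (fun x hx hc => hn ⟨x, hc, hx⟩)
      refine (hmem B y).1 hy Vᶜ (by rwa [compl_compl]) ?_ hyV
      intro b hb hbV
      obtain ⟨u, hu, rfl⟩ := hVU hbV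
      exact hu (fun F hF => hF.2 hb)
    · rintro _ ⟨x, hx, rfl⟩
      rw [hmem]
      intro F hF hBF
      exact hx (f ⁻¹' F) ⟨hcont _ hF, preimage_mono hBF⟩
  · intro h y U hU hyU
    have hy : y ∉ gCl ν (f '' U)ᶜ := by
      rw [h]
      rintro ⟨x, hx, hxy⟩
      refine hx Uᶜ ⟨by rwa [compl_compl], ?_⟩ (hyU hxy)
      intro z hz hzU
      exact hz ⟨z, hzU, rfl⟩
    rw [hmem] at hy
    push Not at hy
    obtain ⟨F, hF, hBF, hyF⟩ := hy
    exact ⟨Fᶜ, ⟨hF, compl_subset_comm.1 hBF⟩, hyF⟩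
end
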